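/- Let G be a finite simple graph that contains no induced subgraph isomorphic to P4 ∪ K1 (the disjoint union of a path on four vertices and a single isolated vertex) and no induced subgraph isomorphic to the Kite (the 5-vertex graph obtained from the diamond K4 minus an edge by adding a pendant vertex adjacent to one of the two degree-2 vertices of the diamond). Then χ(G) ≤ ⌈(Δ(G) + ω(G) + 1)/2⌉. -/

import Mathlib

open SimpleGraph

/-- `P4 ∪ K1`: the disjoint union of a path on four vertices (`0-1-2-3`) and an
isolated vertex (`4`). -/
def p4UnionK1 : SimpleGraph (Fin 5) :=
  SimpleGraph.fromRel (fun a b =>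
    (a = 0 ∧ b = 1) ∨ (a = 1 ∧ b = 2) ∨ (a = 2 ∧ b = 3))

/-- The Kite: the diamond (`K4` minus the edge `23`) on `{0,1,2,3}` together with a
pendant vertex `4` adjacent to the degree-2 vertex `2`. -/
def kite : SimpleGraph (Fin 5) :=
  SimpleGraph.fromRel (fun a b =>
    (a = 0 ∧ b = 1) ∨ (a = 0 ∧ b = 2) ∨ (a = 0 ∧ b = 3) ∨
    (a = 1 ∧ b = 2) ∨ (a = 1 ∧ b = 3) ∨ (a = 2 ∧ b = 4))

/-- No induced `P4 ∪ K1`, in terms of adjacency. -/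
def NoP4K1 {V : Type*} (G : SimpleGraph V) : Prop :=
  ∀ a b c d e, G.Adj a b → G.Adj b c → G.Adj c d → ¬ G.Adj a c → ¬ G.Adj a d → ¬ G.Adj b d →
    ¬ G.Adj e a → ¬ G.Adj e b → ¬ G.Adj e c → ¬ G.Adj e d → False

/-- No induced kite, in terms of adjacency: `a, b` are the vertices of degree three in the
diamond `{a, b, c, d}` and `e` is pendant at `c`. -/
def NoKite {V : Type*} (G : SimpleGraph V) : Prop :=
  ∀ a b c d e, G.Adj a b → G.Adj a c → G.Adj b c → G.Adj a d → G.Adj b d → G.Adj c e →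
    ¬ G.Adj c d → ¬ G.Adj a e → ¬ G.Adj b e → ¬ G.Adj d e → False

/-- The local properties of a minimal counterexample. -/
structure Obstruction {V : Type*} (G : SimpleGraph V) : Prop where
  noP4K1 : NoP4K1 G
  noKite : NoKite G
  exists_triangle : ∀ v, ∃ a b c, G.Adj a b ∧ G.Adj a c ∧ G.Adj b c ∧
    ¬ G.Adj v a ∧ ¬ G.Adj v b ∧ ¬ G.Adj v c
  noDiamond : ∀ v a b c d, ¬ G.Adj v a → ¬ G.Adj v b → ¬ G.Adj v c → ¬ G.Adj v d →
    G.Adj a b → G.Adj a c → G.Adj b c → G.Adj a d → G.Adj b d → c ≠ d → G.Adj c d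
  noTwins : ∀ x y, G.Adj x y → ∃ u, u ≠ x ∧ u ≠ y ∧
    (G.Adj u x ∧ ¬ G.Adj u y ∨ ¬ G.Adj u x ∧ G.Adj u y)

namespace Obstruction

variable {V : Type*} {G : SimpleGraph V}

theorem adj_third (h : Obstruction G) {v a s t u : V} (hs : ¬ G.Adj v s) (ht : ¬ G.Adj v t)
    (hu : ¬ G.Adj v u) (hst : G.Adj s t) (hsu : G.Adj s u) (htu : G.Adj t u) (hav : G.Adj v a)
    (has : G.Adj a s) (hat : G.Adj a t) : G.Adj a u := by
  by_contra hau
  exact h.noKite s t a u v hst has.symm hat.symm hsu htu hav.symm hau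
    (fun e => hs e.symm) (fun e => ht e.symm) (fun e => hu e.symm)

/-- A paw with triangle `r, x, y` and pendant vertex `i` at `r`, anticomplete to `v`. -/
structure Paw (G : SimpleGraph V) (v r x y i : V) : Prop where
  vr : ¬ G.Adj v r
  vx : ¬ G.Adj v x
  vy : ¬ G.Adj v y
  vi : ¬ G.Adj v i
  rx : G.Adj r x
  ry : G.Adj r y
  xy : G.Adj x y
  ri : G.Adj r i
  xi : ¬ G.Adj x i
  yi : ¬ G.Adj y i

theorem Paw.symm {v r x y i : V} (p : Paw G v r x y i) : Paw G v r y x i :=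
  ⟨p.vr, p.vy, p.vx, p.vi, p.ry, p.rx, p.xy.symm, p.ri, p.yi, p.xi⟩

/-- In an obstruction, a vertex anticomplete to `v` does not separate `x` from `y`. -/
theorem Paw.adj_of_adj {v r x y i : V} (p : Paw G v r x y i) (h : Obstruction G)
    {u : V} (huy : u ≠ y) (huv : ¬ G.Adj v u) (hux : G.Adj u x) : G.Adj u y := by
  obtain ⟨vr, vx, vy, vi, rx, ry, xy, ri, xi, yi⟩ := p
  by_contra hn
  by_cases hur : G.Adj u r
  · exact hn (h.noDiamond v r x y u vr vx vy huv rx ry xy hur.symm hux.symm huy.symm).symm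
  by_cases hui : G.Adj u i
  · exact h.noP4K1 u i r y v hui ri.symm ry hur hn (fun e => yi e.symm) huv vi vr vy
  · exact h.noP4K1 u x r i v hux rx.symm ri hur hui xi huv vx vr vi

/-- Such a paw comes with a neighbour `a` of `v` adjacent to `i` and to `x` only. -/
structure Mark (G : SimpleGraph V) (v r x y i a : V) : Prop where
  va : G.Adj v a
  ai : G.Adj a i
  ax : G.Adj a x
  ay : ¬ G.Adj a y
  ar : ¬ G.Adj a r

theorem Paw.mark_of_separates {v r x y i u : V} (p : Paw G v r x y i) (h : Obstruction G)
    (huy : u ≠ y) (hux : G.Adj u x) (hn : ¬ G.Adj u y) : Mark G v r x y i u := by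
  have huv : G.Adj v u := by
    by_contra hv
    exact hn (p.adj_of_adj h huy hv hux)
  obtain ⟨vr, vx, vy, vi, rx, ry, xy, ri, xi, yi⟩ := p
  have hur : ¬ G.Adj u r := fun hr =>
    hn (h.adj_third vr vx vy rx ry xy huv hr hux)
  refine ⟨huv, ?_, hux, hn, hur⟩
  by_contra hui
  exact h.noP4K1 v u x y i huv hux xy vx vy hn (fun e => vi e.symm) (fun e => hui e.symm)
    (fun e => xi e.symm) (fun e => yi e.symm)

theorem Paw.exists_mark {v r x y i : V} (p : Paw G v r x y i) (h : Obstruction G) :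
    ∃ a, Mark G v r x y i a ∨ Mark G v r y x i a := by
  obtain ⟨u, hux, huy, ⟨h1, h2⟩ | ⟨h1, h2⟩⟩ := h.noTwins x y p.xy
  · exact ⟨u, Or.inl (p.mark_of_separates h huy h1 h2)⟩
  · exact ⟨u, Or.inr (p.symm.mark_of_separates h hux h2 h1)⟩

/-- Vertices that see neither `v` nor `x` see every mark of `y`. -/
theorem Paw.mark_adj {v r x y i a u : V} (p : Paw G v r x y i) (h : Obstruction G)
    (m : Mark G v r y x i a) (hv : ¬ G.Adj v u) (hux : ¬ G.Adj x u) (hne : u ≠ x) :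
    G.Adj a u := by
  by_contra hau
  have huy : ¬ G.Adj u y := fun e => hux (p.symm.adj_of_adj h hne hv e).symm
  exact h.noP4K1 v a y x u m.va m.ax p.xy.symm p.vy p.vx m.ay (fun e => hv e.symm)
    (fun e => hau e.symm) huy (fun e => hux e.symm)

/-- Neighbours of `v` that see neither `x` nor `i` see every mark of `y`. -/
theorem Paw.mark_adj' {v r x y i a u : V} (p : Paw G v r x y i) (h : Obstruction G)
    (m : Mark G v r y x i a) (hv : G.Adj v u) (hux : ¬ G.Adj x u) (hui : ¬ G.Adj i u) :
    G.Adj a u := by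
  by_contra hau
  exact h.noP4K1 u v a i x hv.symm m.va m.ai (fun e => hau e.symm) (fun e => hui e.symm)
    p.vi hux (fun e => p.vx e.symm) (fun e => m.ay e.symm) p.xi

theorem Paw.two_marks_false {v r x y z i a b : V} (h : Obstruction G) (p : Paw G v r x y i)
    (q : Paw G v r x z i) (hyz : G.Adj y z) (m : Mark G v r y x i a) (n : Mark G v r z x i b) :
    False := by
  have hab : ¬ G.Adj a b := fun e =>
    h.noKite a b i v r e m.ai n.ai m.va.symm n.va.symm p.ri.symm (fun e => p.vi e.symm)
      m.ar n.ar p.vr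
  have hne : a ≠ b := by
    rintro rfl
    exact m.ar (h.adj_third p.vy q.vy p.vr hyz p.ry.symm q.ry.symm m.va m.ax n.ax)
  have xv : ¬ G.Adj x v := fun e => p.vx e.symm
  have xa : ¬ G.Adj x a := fun e => m.ay e.symm
  have xb : ¬ G.Adj x b := fun e => n.ay e.symm
  have key : ∀ u, G.Adj v u → ¬ G.Adj x u → G.Adj u i := by
    intro u hv hx
    by_contra hi
    have h1 := p.mark_adj' h m hv hx (fun e => hi e.symm)
    have h2 := q.mark_adj' h n hv hx (fun e => hi e.symm)
    exact hab (h.noDiamond x v u a b xv hx xa xb hv m.va h1.symm n.va h2.symm hne)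
  have indep : ∀ u w, G.Adj v u → ¬ G.Adj x u → G.Adj v w → ¬ G.Adj x w → ¬ G.Adj u w := by
    intro u w hu hxu hw hxw huw
    exact p.vi (h.noDiamond x u w v i hxu hxw xv p.xi huw hu.symm hw.symm (key u hu hxu)
      (key w hw hxw) (by rintro rfl; exact p.vr p.ri.symm))
  have far : ∀ u w, ¬ G.Adj v u → ¬ G.Adj x u → ¬ G.Adj v w → ¬ G.Adj x w → ¬ G.Adj u w := by
    intro u w hu hxu hw hxw huw
    have hux : u ≠ x := by rintro rfl; exact hxw huw
    have hwx : w ≠ x := by rintro rfl; exact hxu huw.symm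
    exact hab (h.noDiamond x u w a b hxu hxw xa xb huw (p.mark_adj h m hu hxu hux).symm
      (p.mark_adj h m hw hxw hwx).symm (q.mark_adj h n hu hxu hux).symm
      (q.mark_adj h n hw hxw hwx).symm hne)
  obtain ⟨t1, t2, t3, h12, h13, h23, k1, k2, k3⟩ := h.exists_triangle x
  by_cases e1 : G.Adj v t1 <;> by_cases e2 : G.Adj v t2 <;> by_cases e3 : G.Adj v t3 <;>
    grind

/-- In an obstruction no `v` is anticomplete to a `K4` with a pendant edge. -/
theorem triple_false (h : Obstruction G) {v r x y z i : V} (p : Paw G v r x y i)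
    (q : Paw G v r x z i) (hyz : G.Adj y z) : False := by
  have s : Paw G v r y z i := ⟨p.vr, p.vy, q.vy, p.vi, p.ry, q.ry, hyz, p.ri, p.yi, q.yi⟩
  have lift : ∀ {x y z a}, Paw G v r x z i → Mark G v r x y i a → G.Adj x y → G.Adj z y →
      Mark G v r x z i a := by
    intro x y z a p m _ _
    refine ⟨m.va, m.ai, m.ax, fun e => m.ar ?_, m.ar⟩
    exact h.adj_third p.vx p.vy p.vr p.xy p.rx.symm p.ry.symm m.va m.ax e
  obtain ⟨a, ha⟩ := p.exists_mark h
  obtain ⟨b, hb⟩ := q.exists_mark h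
  obtain ⟨c, hc⟩ := s.exists_mark h
  rcases ha with ha | ha <;> rcases hb with hb | hb <;> rcases hc with hc | hc
  · exact Paw.two_marks_false h q.symm s.symm p.xy (lift q ha p.xy hyz.symm) hc
  · exact Paw.two_marks_false h p.symm s q.xy (lift p hb q.xy hyz) hc
  · exact Paw.two_marks_false h q.symm s.symm p.xy (lift q ha p.xy hyz.symm) hc
  · exact Paw.two_marks_false h p.symm s q.xy ha hc
  · exact Paw.two_marks_false h q.symm s.symm p.xy hb hc
  · exact Paw.two_marks_false h p.symm s q.xy (lift p hb q.xy hyz) hc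
  · exact Paw.two_marks_false h p q hyz ha hb
  · exact Paw.two_marks_false h p q hyz ha hb

theorem mark_false (h : Obstruction G) {v r x y i a : V} (p : Paw G v r x y i)
    (m : Mark G v r y x i a) : False := by
  have xv : ¬ G.Adj x v := fun e => p.vx e.symm
  have xa : ¬ G.Adj x a := fun e => m.ay e.symm
  have noC : ∀ c, G.Adj v c → G.Adj x c → G.Adj y c → ¬ G.Adj i c → False := by
    intro c vc xc yc ic
    have cr : G.Adj c r :=
      h.adj_third p.vx p.vy p.vr p.xy p.rx.symm p.ry.symm vc xc.symm yc.symm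
    have ca : ¬ G.Adj c a := fun e => 
      h.noKite c y a x i yc.symm e m.ax.symm xc.symm p.xy.symm m.ai m.ay
        (fun e => ic e.symm) p.yi p.xi
    have key : ∀ u, G.Adj v u → ¬ G.Adj x u → G.Adj u i := by
      intro u vu xu
      by_contra hi
      have au := p.mark_adj' h m vu xu (fun e => hi e.symm)
      by_cases cu : G.Adj c u
      · exact ca (h.adj_third xv xu xa vu m.va au.symm xc vc.symm cu)
      · exact h.noP4K1 x c v u i xc vc.symm vu xv xu cu (fun e => p.xi e.symm) ic
          (fun e => p.vi e.symm) (fun e => hi e.symm)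
    have indep : ∀ u w, G.Adj v u → ¬ G.Adj x u → G.Adj v w → ¬ G.Adj x w → ¬ G.Adj u w := by
      intro u w hu hxu hw hxw huw
      exact p.vi (h.noDiamond x u w v i hxu hxw xv p.xi huw hu.symm hw.symm (key u hu hxu)
        (key w hw hxw) (by rintro rfl; exact p.vr p.ri.symm))
    have far : ∀ u w, ¬ G.Adj v u → ¬ G.Adj x u → ¬ G.Adj v w → ¬ G.Adj x w →
        G.Adj u w → G.Adj c u := by
      intro u w hu hxu hw hxw huw
      by_contra cu
      have hux : u ≠ x := by rintro rfl; exact hxw huw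
      have hwx : w ≠ x := by rintro rfl; exact hxu huw.symm
      have au := p.mark_adj h m hu hxu hux
      have aw := p.mark_adj h m hw hxw hwx
      by_cases ru : G.Adj r u
      · by_cases rw' : G.Adj r w
        · exact h.noKite u w a r v huw au.symm aw.symm ru.symm rw'.symm m.va.symm m.ar
            (fun e => hu e.symm) (fun e => hw e.symm) (fun e => p.vr e.symm)
        · exact h.noP4K1 w u r x v huw.symm ru.symm p.rx (fun e => rw' e.symm)
            (fun e => hxw e.symm) (fun e => hxu e.symm) hw hu p.vr p.vx
      · by_cases iu : G.Adj i u
        · exact h.noP4K1 u i r x v iu.symm p.ri.symm p.rx (fun e => ru e.symm)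
            (fun e => hxu e.symm) (fun e => p.xi e.symm) hu p.vi p.vr p.vx
        · exact h.noP4K1 v c r i u vc cr p.ri p.vr p.vi (fun e => ic e.symm)
            (fun e => hu e.symm) (fun e => cu e.symm) (fun e => ru e.symm) (fun e => iu e.symm)
    have far' : ∀ u w, ¬ G.Adj v u → ¬ G.Adj x u → ¬ G.Adj v w → ¬ G.Adj x w →
        ¬ G.Adj u w := by
      intro u w hu hxu hw hxw huw
      have hux : u ≠ x := by rintro rfl; exact hxw huw
      have hwx : w ≠ x := by rintro rfl; exact hxu huw.symm
      exact ca (h.adj_third hxu hxw xa huw (p.mark_adj h m hu hxu hux).symm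
        (p.mark_adj h m hw hxw hwx).symm xc (far u w hu hxu hw hxw huw)
        (far w u hw hxw hu hxu huw.symm))
    obtain ⟨t1, t2, t3, h12, h13, h23, k1, k2, k3⟩ := h.exists_triangle x
    by_cases e1 : G.Adj v t1 <;> by_cases e2 : G.Adj v t2 <;> by_cases e3 : G.Adj v t3 <;>
      grind
  have iv : ¬ G.Adj i v := fun e => p.vi e.symm
  have near : ∀ u, G.Adj v u → ¬ G.Adj i u → ¬ G.Adj x u ∧ ¬ G.Adj y u ∧ G.Adj a u := by
    intro u vu iu
    have hx : ¬ G.Adj x u := by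
      intro xu
      by_cases yu : G.Adj y u
      · exact noC u vu xu yu iu
      · exact h.noP4K1 v u x y i vu xu.symm p.xy p.vx p.vy (fun e => yu e.symm) iv iu
          (fun e => p.xi e.symm) (fun e => p.yi e.symm)
    refine ⟨hx, ?_, p.mark_adj' h m vu hx iu⟩
    intro yu
    exact h.noP4K1 v u y x i vu yu.symm p.xy.symm p.vy p.vx (fun e => hx e.symm) iv iu
      (fun e => p.yi e.symm) (fun e => p.xi e.symm)
  have indep : ∀ u w, G.Adj v u → ¬ G.Adj i u → G.Adj v w → ¬ G.Adj i w → ¬ G.Adj u w := by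
    intro u w vu iu vw iw uw
    obtain ⟨xu, -, au⟩ := near u vu iu
    obtain ⟨xw, -, aw⟩ := near w vw iw
    exact h.triple_false (v := x) (r := a) (x := v) (y := u) (z := w) (i := i)
      ⟨xa, xv, xu, p.xi, m.va.symm, au, vu, m.ai, p.vi, fun e => iu e.symm⟩
      ⟨xa, xv, xw, p.xi, m.va.symm, aw, vw, m.ai, p.vi, fun e => iw e.symm⟩ uw
  have dich : ∀ u, ¬ G.Adj v u → ¬ G.Adj i u → u ≠ x → u ≠ y →
      ¬ G.Adj x u ∧ ¬ G.Adj y u ∧ G.Adj a u := by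
    intro u vu iu ux uy
    have hx : ¬ G.Adj x u := by
      intro xu
      have yu := p.adj_of_adj h uy vu xu.symm
      by_cases ru : G.Adj r u
      · exact h.triple_false p ⟨p.vr, p.vx, vu, p.vi, p.rx, ru, xu, p.ri, p.xi,
          fun e => iu e.symm⟩ yu.symm
      · exact ru (h.noDiamond v x y r u p.vx p.vy p.vr vu p.xy p.rx.symm p.ry.symm xu yu.symm
          (by rintro rfl; exact iu p.ri.symm))
    exact ⟨hx, fun yu => hx (p.symm.adj_of_adj h ux vu yu.symm).symm, p.mark_adj h m vu hx ux⟩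
  obtain ⟨t1, t2, t3, h12, h13, h23, k1, k2, k3⟩ := h.exists_triangle i
  have mixed : ∀ u w, G.Adj v u → ¬ G.Adj i u → ¬ G.Adj v w → ¬ G.Adj i w → w ≠ v →
      ¬ G.Adj u w := by
    intro u w vu iu vw iw wv uw
    obtain ⟨xu, yu, au⟩ := near u vu iu
    have wx : w ≠ x := by rintro rfl; exact xu uw.symm
    have wy : w ≠ y := by rintro rfl; exact yu uw.symm
    obtain ⟨xw, yw, aw⟩ := dich w vw iw wx wy
    exact vw (h.noDiamond x a u v w xa xu xv xw au m.va.symm vu.symm aw uw wv.symm)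
  have all_far : ∀ s t u, G.Adj s t → G.Adj s u → G.Adj t u → ¬ G.Adj i s → ¬ G.Adj i t →
      ¬ G.Adj i u → ¬ G.Adj v s := by
    intro s t u st su tu is it iu vs
    by_cases vt : G.Adj v t
    · exact indep s t vs is vt it st
    by_cases tv : t = v
    · subst tv
      exact indep s u vs is tu iu su
    · exact mixed s t vs is vt it tv st
  have f1 := all_far t1 t2 t3 h12 h13 h23 k1 k2 k3
  have f2 := all_far t2 t1 t3 h12.symm h23 h13 k2 k1 k3
  have f3 := all_far t3 t1 t2 h13.symm h23.symm h12 k3 k1 k2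
  have ne : ∀ s t u, G.Adj s t → G.Adj s u → G.Adj t u → ¬ G.Adj i s → ¬ G.Adj i t →
      ¬ G.Adj i u → ¬ G.Adj v s → ¬ G.Adj v t → ¬ G.Adj v u → s ≠ x ∧ s ≠ y := by
    intro s t u st su tu is it iu vs vt vu
    grind [SimpleGraph.Adj.ne]
  obtain ⟨n1, n1'⟩ := ne t1 t2 t3 h12 h13 h23 k1 k2 k3 f1 f2 f3
  obtain ⟨n2, n2'⟩ := ne t2 t1 t3 h12.symm h23 h13 k2 k1 k3 f2 f1 f3
  obtain ⟨n3, n3'⟩ := ne t3 t1 t2 h13.symm h23.symm h12 k3 k1 k2 f3 f1 f2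
  obtain ⟨x1, -, a1⟩ := dich t1 f1 k1 n1 n1'
  obtain ⟨x2, -, a2⟩ := dich t2 f2 k2 n2 n2'
  obtain ⟨x3, -, a3⟩ := dich t3 f3 k3 n3 n3'
  exact h.triple_false (v := x) (r := a) (x := t1) (y := t2) (z := t3) (i := v)
    ⟨xa, x1, x2, xv, a1, a2, h12, m.va.symm, fun e => f1 e.symm, fun e => f2 e.symm⟩
    ⟨xa, x1, x3, xv, a1, a3, h13, m.va.symm, fun e => f1 e.symm, fun e => f3 e.symm⟩ h23

/-- In an obstruction no vertex is anticomplete to a paw. -/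
theorem paw_false (h : Obstruction G) {v r x y i : V} (p : Paw G v r x y i) : False := by
  obtain ⟨a, m | m⟩ := p.exists_mark h
  · exact h.mark_false p.symm m
  · exact h.mark_false p m

/-- A vertex outside `N(v)` that sees one vertex of a triangle outside `N(v)` sees all of it. -/
theorem adj_triangle (h : Obstruction G) {v a b c u : V} (va : ¬ G.Adj v a) (vb : ¬ G.Adj v b)
    (vc : ¬ G.Adj v c) (vu : ¬ G.Adj v u) (ab : G.Adj a b) (ac : G.Adj a c) (bc : G.Adj b c)
    (au : G.Adj a u) (hub : u ≠ b) : G.Adj b u := by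
  by_cases huc : u = c
  · exact huc ▸ bc
  by_contra bu
  by_cases cu : G.Adj c u
  · exact bu (h.noDiamond v a c b u va vc vb vu ac ab bc.symm au cu hub.symm)
  · exact h.paw_false (v := v) (r := a) (x := b) (y := c) (i := u)
      ⟨va, vb, vc, vu, ab, ac, bc, au, bu, cu⟩

theorem adj_triangle_of_mark (h : Obstruction G) {v a b c s l : V} (va : ¬ G.Adj v a)
    (vb : ¬ G.Adj v b) (vc : ¬ G.Adj v c) (ab : G.Adj a b) (ac : G.Adj a c) (bc : G.Adj b c)
    (sa : G.Adj s a) (sb : ¬ G.Adj s b) (sne : s ≠ b) (vl : ¬ G.Adj v l) (lv : l ≠ v) : 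
    G.Adj a l ∨ l = a := by
  have vs : G.Adj v s := by
    by_contra vs
    exact sb (h.adj_triangle va vb vc vs ab ac bc sa.symm sne).symm
  have sc : ¬ G.Adj s c := fun sc =>
    sb (h.adj_third va vc vb ac ab bc.symm vs sa sc)
  by_contra! hl
  obtain ⟨al, la⟩ := hl
  have clique : ∀ l, ¬ G.Adj v l → ¬ G.Adj a l → l ≠ a → G.Adj s l := by
    intro l vl al la
    have bl : ¬ G.Adj b l := fun e => al (h.adj_triangle vb va vc vl ab.symm bc ac e la)
    by_contra sl
    exact h.noP4K1 v s a b l vs sa ab va vb sb (fun e => vl e.symm) (fun e => sl e.symm)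
      (fun e => al e.symm) (fun e => bl e.symm)
  have cl : ¬ G.Adj c l := fun e => al (h.adj_triangle vc va vb vl ac.symm bc.symm ab e la)
  have sl := clique l vl al la
  have cv : ¬ G.Adj c v := fun e => vc e.symm
  have cs : ¬ G.Adj c s := fun e => sc e.symm
  obtain ⟨t1, t2, t3, h12, h13, h23, k1, k2, k3⟩ := h.exists_triangle c
  have nov : ∀ t u w, G.Adj t u → G.Adj t w → G.Adj u w → ¬ G.Adj c t → ¬ G.Adj c u →
      ¬ G.Adj c w → ¬ G.Adj s t := by
    intro t u w tu tw uw ct cu cw st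
    have su : ¬ G.Adj u s → s = u := by
      intro us
      by_contra hne
      exact us (h.adj_triangle ct cu cw cs tu tw uw st.symm hne)
    by_cases hsu : s = u
    · subst hsu
      have h1 : G.Adj t v ∨ v = t := by
        by_contra! e
        exact e.1 (h.adj_triangle cs ct cw cv tu.symm uw tw vs.symm e.2)
      have h2 : G.Adj t l ∨ l = t := by
        by_contra! e
        exact e.1 (h.adj_triangle cs ct cw cl tu.symm uw tw sl e.2)
      have h3 : v = t ∨ l = t → False := by
        rintro (rfl | rfl)
        · exact vl (h2.resolve_right lv)
        · exact vl (h1.resolve_right lv.symm).symm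
      exact vl (h.noDiamond c t s v l ct cs cv cl tu (h1.resolve_right fun e => h3 (.inl e))
        vs.symm (h2.resolve_right fun e => h3 (.inr e)) sl lv.symm)
    · have us : G.Adj u s := by
        by_contra e
        exact hsu (su e)
      have h1 : v ≠ t → G.Adj t v := fun e =>
        (h.adj_triangle cs ct cu cv st us.symm tu vs.symm e)
      have h2 : l ≠ t → G.Adj t l := fun e =>
        (h.adj_triangle cs ct cu cl st us.symm tu sl e)
      by_cases hvt : v = t
      · subst hvt
        exact vl (h2 lv)
      by_cases hlt : l = t
      · subst hlt
        exact vl (h1 hvt).symm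
      exact vl (h.noDiamond c t s v l ct cs cv cl st.symm (h1 hvt) vs.symm (h2 hlt) sl lv.symm)
  have at_all : ∀ t u w, G.Adj t u → G.Adj t w → G.Adj u w → ¬ G.Adj c t → ¬ G.Adj c u →
      ¬ G.Adj c w → ¬ G.Adj v t → t ≠ c → False := by
    intro t u w tu tw uw ct cu cw vt hc
    have hta : t ≠ a := by rintro rfl; exact ct ac.symm
    have at' : ¬ G.Adj a t := fun e => ct (h.adj_triangle va vc vb vt ac ab bc.symm e hc)
    exact nov t u w tu tw uw ct cu cw (clique t vt at' hta)
  have hc1 : t1 ≠ c := by rintro rfl; exact k2 h12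
  have hc2 : t2 ≠ c := by rintro rfl; exact k1 h12.symm
  have v1 : G.Adj v t1 := by
    by_contra e
    exact at_all t1 t2 t3 h12 h13 h23 k1 k2 k3 e hc1
  have n1 := nov t1 t2 t3 h12 h13 h23 k1 k2 k3
  have n2 := nov t2 t1 t3 h12.symm h23 h13 k2 k1 k3
  by_cases hst : s = t2
  · subst hst; exact n1 h12.symm
  by_cases v2 : G.Adj v t2
  · have hs1 : s ≠ t1 := by rintro rfl; exact n2 h12
    exact n1 (h.adj_triangle cv k1 k2 cs v1 v2 h12 vs hs1).symm
  · exact at_all t2 t1 t3 h12.symm h23 h13 k2 k1 k3 v2 hc2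

/-- In an obstruction the non-neighbours of every vertex form a clique. -/
theorem nonadj_clique (h : Obstruction G) {v l m : V} (vl : ¬ G.Adj v l) (vm : ¬ G.Adj v m)
    (lv : l ≠ v) (mv : m ≠ v) (lm : l ≠ m) : G.Adj l m := by
  obtain ⟨a, b, c, ab, ac, bc, va, vb, vc⟩ := h.exists_triangle v
  have core : ∀ a b c, G.Adj a b → G.Adj a c → G.Adj b c → ¬ G.Adj v a → ¬ G.Adj v b →
      ¬ G.Adj v c → (∃ s, s ≠ b ∧ G.Adj s a ∧ ¬ G.Adj s b) → G.Adj l m := by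
    rintro a b c ab ac bc va vb vc ⟨s, hsb, sa, sb⟩
    have h1 := h.adj_triangle_of_mark va vb vc ab ac bc sa sb hsb vl lv
    have h2 := h.adj_triangle_of_mark va vb vc ab ac bc sa sb hsb vm mv
    rcases h1 with al | rfl
    · rcases h2 with am | rfl
      · by_cases lb : l = b
        · subst lb
          exact h.adj_triangle va vl vc vm ab ac bc am lm.symm
        by_cases mb : m = b
        · subst mb
          exact (h.adj_triangle va vm vc vl ab ac bc al lm).symm
        exact h.noDiamond v a b l m va vb vl vm ab al (h.adj_triangle va vb vc vl ab ac bc al lb)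
          am (h.adj_triangle va vb vc vm ab ac bc am mb) lm
      · exact al.symm
    · exact h2.resolve_right lm.symm
  obtain ⟨u, hua, hub, ⟨h1, h2⟩ | ⟨h1, h2⟩⟩ := h.noTwins a b ab
  · exact core a b c ab ac bc va vb vc ⟨u, hub, h1, h2⟩
  · exact core b a c ab.symm bc ac vb va vc ⟨u, hua, h2, h1⟩

end Obstruction

/-- `G` has a proper colouring of the vertices in `s` with colours `0, …, n - 1`. -/
def ColorableOn {V : Type*} (G : SimpleGraph V) (s : Finset V) (n : ℕ) : Prop :=
  ∃ f : V → ℕ, (∀ x ∈ s, f x < n) ∧ ∀ x ∈ s, ∀ y ∈ s, G.Adj x y → f x ≠ f y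

/-- Every vertex of `s` has at most `d` neighbours in `s`. -/
def DegreeBound {V : Type*} (G : SimpleGraph V) (s : Finset V) (d : ℕ) : Prop :=
  ∀ x ∈ s, ∀ t ⊆ s, (∀ y ∈ t, G.Adj x y) → t.card ≤ d

/-- Every clique inside `s` has at most `w` vertices. -/
def CliqueBound {V : Type*} (G : SimpleGraph V) (s : Finset V) (w : ℕ) : Prop :=
  ∀ t ⊆ s, G.IsClique (t : Set V) → t.card ≤ w

/-- Reed's bound holds for the subgraph induced by `s`. -/
def ReedOn {V : Type*} (G : SimpleGraph V) (s : Finset V) : Prop :=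
  ∀ d w, DegreeBound G s d → CliqueBound G s w → ColorableOn G s ((d + w + 2) / 2)

section Coloring

variable {V : Type*} {G : SimpleGraph V} {s t : Finset V} {n m w : ℕ}

theorem ColorableOn.mono (h : ColorableOn G s n) (hts : t ⊆ s) (hnm : n ≤ m) :
    ColorableOn G t m := by
  obtain ⟨f, h1, h2⟩ := h
  exact ⟨f, fun x hx => (h1 x (hts hx)).trans_le hnm,
    fun x hx y hy => h2 x (hts hx) y (hts hy)⟩

theorem ColorableOn.union [DecidableEq V] (hs : ColorableOn G s n) (ht : ColorableOn G t m) :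
    ColorableOn G (s ∪ t) (n + m) := by
  obtain ⟨f, f1, f2⟩ := hs
  obtain ⟨g, g1, g2⟩ := ht
  refine ⟨fun x => if x ∈ s then f x else n + g x, ?_, ?_⟩
  · intro x hx
    have := f1 x
    have := g1 x
    grind
  · intro x hx y hy hxy
    have := f1 x
    have := f1 y
    have := f2 x
    have := g2 x
    grind

theorem colorableOn_card (G : SimpleGraph V) (s : Finset V) : ColorableOn G s s.card := by
  classical
  refine ⟨fun x => if hx : x ∈ s then s.equivFin ⟨x, hx⟩ else 0, ?_, ?_⟩
  · intro x hx
    simp [hx]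
  · intro x hx y hy hxy
    simp only [hx, hy, dif_pos]
    intro h
    have := s.equivFin.injective (Fin.ext h)
    exact hxy.ne (by simpa using this)

theorem colorableOn_one_of_stable (h : ∀ x ∈ s, ∀ y ∈ s, ¬ G.Adj x y) : ColorableOn G s 1 :=
  ⟨fun _ => 0, fun _ _ => one_pos, fun x hx y hy hxy => absurd hxy (h x hx y hy)⟩

/-- If `φ` injects `s` into `t` along non-edges, then `s ∪ t` needs at most `t.card` colours. -/
theorem colorableOn_union_of_injection [DecidableEq V] (φ : V → V) (hφ : ∀ x ∈ s, φ x ∈ t)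
    (hinj : ∀ x ∈ s, ∀ y ∈ s, φ x = φ y → x = y) (hadj : ∀ x ∈ s, ¬ G.Adj x (φ x)) :
    ColorableOn G (s ∪ t) t.card := by
  let c : V → ℕ := fun x => if hx : x ∈ t then t.equivFin ⟨x, hx⟩ else 0
  have clt : ∀ x ∈ t, c x < t.card := fun x hx => by simp [c, hx]
  have cinj : ∀ x ∈ t, ∀ y ∈ t, c x = c y → x = y := by
    intro x hx y hy h
    simp only [c, hx, hy, dif_pos] at h
    simpa using t.equivFin.injective (Fin.ext h)
  refine ⟨fun x => if x ∈ t then c x else c (φ x), ?_, ?_⟩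
  · intro x hx
    grind
  · intro x hx y hy hxy
    have := hxy.ne
    have := hxy.symm
    grind

theorem IsClique.exists_nonadj_of_card [DecidableEq V] (hw : CliqueBound G s w) (hts : t ⊆ s)
    (ht : G.IsClique (t : Set V)) (hcard : w ≤ t.card) {u : V} (hu : u ∈ s) (hut : u ∉ t) :
    ∃ x ∈ t, ¬ G.Adj u x := by
  by_contra! h
  have h1 := hw (insert u t) (Finset.insert_subset hu hts) (by
    rw [Finset.coe_insert, SimpleGraph.isClique_insert]
    exact ⟨ht, fun b hb _ => h b hb⟩)
  rw [Finset.card_insert_of_notMem hut] at h1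
  omega

theorem colorableOn_half_aux [DecidableEq V] (hw : CliqueBound G s w) :
    ColorableOn G s ((s.card + w) / 2) ∧
      (¬ G.IsClique (s : Set V) → ColorableOn G s ((s.card + w - 1) / 2)) := by
  induction s using Finset.strongInduction with
  | H s ih =>
  by_cases hc : G.IsClique (s : Set V)
  · have := hw s subset_rfl hc
    exact ⟨(colorableOn_card G s).mono subset_rfl (by omega), fun h => absurd hc h⟩
  suffices h : ColorableOn G s ((s.card + w - 1) / 2) from
    ⟨h.mono subset_rfl (by omega), fun _ => h⟩
  obtain ⟨u, hu, v, hv, huv, hnadj⟩ : ∃ u ∈ s, ∃ v ∈ s, u ≠ v ∧ ¬ G.Adj u v := by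
    simpa [SimpleGraph.isClique_iff, Set.Pairwise] using hc
  set t := (s.erase u).erase v with ht
  have hvs : v ∈ s.erase u := Finset.mem_erase.2 ⟨huv.symm, hv⟩
  have hcard : t.card + 2 = s.card := by
    have h1 := Finset.card_erase_add_one hvs
    have h2 := Finset.card_erase_add_one hu
    rw [← ht] at h1
    omega
  have hts : t ⊆ s := (Finset.erase_subset _ _).trans (Finset.erase_subset _ _)
  have hst : t ∪ {u, v} = s := by
    ext x
    simp only [ht, Finset.mem_union, Finset.mem_erase, Finset.mem_insert, Finset.mem_singleton]
    grind
  have hwt : CliqueBound G t w := fun S hS => hw S (hS.trans hts)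
  have huv1 : ColorableOn G {u, v} 1 := colorableOn_one_of_stable (by
    intro x hx y hy hxy
    have := hxy.ne
    have := hxy.symm
    grind)
  by_cases htc : G.IsClique (t : Set V)
  · have htw := hwt t subset_rfl htc
    rcases htw.lt_or_eq with hlt | heq
    · have := (colorableOn_card G t).union huv1
      rw [hst] at this
      exact this.mono subset_rfl (by omega)
    · obtain ⟨x, hx, hux⟩ := IsClique.exists_nonadj_of_card hw hts htc heq.ge hu (by simp [ht])
      obtain ⟨y, hy, hvy⟩ := IsClique.exists_nonadj_of_card hw hts htc heq.ge hv (by simp [ht])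
      obtain ⟨f, f1, f2⟩ := colorableOn_card G t
      refine (show ColorableOn G s t.card from
        ⟨fun z => if z = u then f x else if z = v then f y else f z, ?_, ?_⟩).mono
        subset_rfl (by omega)
      · intro z hz
        have : z = u ∨ z = v ∨ z ∈ t := by rw [← hst] at hz; grind
        grind
      · intro a ha b hb hab
        have hab' := hab.symm
        have hne := hab.ne
        have h1 : a = u ∨ a = v ∨ a ∈ t := by rw [← hst] at ha; grind
        have h2 : b = u ∨ b = v ∨ b ∈ t := by rw [← hst] at hb; grind
        have key : ∀ p ∈ t, ∀ q ∈ t, p ≠ q → f p ≠ f q := fun p hp q hq hpq =>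
          f2 p hp q hq (htc hp hq hpq)
        grind
  · have h2 : 2 ≤ t.card := by
      by_contra hlt
      refine htc fun a ha b hb hab => ?_
      exact absurd (Finset.card_le_one.1 (by omega) a ha b hb) hab
    have htss : t ⊂ s := Finset.ssubset_iff_subset_ne.2 ⟨hts, by
      intro h
      rw [h] at hcard
      omega⟩
    have := ((ih t htss hwt).2 htc).union huv1
    rw [hst] at this
    exact this.mono subset_rfl (by omega)

theorem colorableOn_half (hw : CliqueBound G s w) : ColorableOn G s ((s.card + w) / 2) := by
  classical exact (colorableOn_half_aux hw).1

theorem colorableOn_half_of_not_isClique (hw : CliqueBound G s w)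
    (hs : ¬ G.IsClique (s : Set V)) : ColorableOn G s ((s.card + w - 1) / 2) := by
  classical exact (colorableOn_half_aux hw).2 hs

/-- Triangle-free graphs without an induced `P4` are bipartite. -/
theorem colorableOn_two [DecidableEq V]
    (hT : ∀ a ∈ s, ∀ b ∈ s, ∀ c ∈ s, G.Adj a b → G.Adj a c → ¬ G.Adj b c)
    (hP : ∀ a ∈ s, ∀ b ∈ s, ∀ c ∈ s, ∀ d ∈ s, G.Adj a b → G.Adj b c → G.Adj c d →
      ¬ G.Adj a c → ¬ G.Adj b d → G.Adj a d) : ColorableOn G s 2 := by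
  classical
  induction s using Finset.strongInduction with
  | H s ih =>
  by_cases hE : ∀ x ∈ s, ∀ y ∈ s, ¬ G.Adj x y
  · exact (colorableOn_one_of_stable hE).mono subset_rfl one_le_two
  push Not at hE
  obtain ⟨x, hx, y, hy, hxy⟩ := hE
  let t := s.filter fun z => ¬ G.Adj x z ∧ ¬ G.Adj y z
  have hts : t ⊆ s := Finset.filter_subset _ _
  have htss : t ⊂ s := Finset.ssubset_iff_subset_ne.2 ⟨hts, fun h => by
    have : x ∈ t := h ▸ hx
    exact (Finset.mem_filter.1 this).2.2 hxy.symm⟩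
  obtain ⟨f, f1, f2⟩ := ih t htss
    (fun a ha b hb c hc => hT a (hts ha) b (hts hb) c (hts hc))
    (fun a ha b hb c hc d hd => hP a (hts ha) b (hts hb) c (hts hc) d (hts hd))
  have hcut : ∀ a ∈ t, ∀ b ∈ s, G.Adj a b → b ∈ t := by
    intro a ha b hb hab
    obtain ⟨has, hxa, hya⟩ := Finset.mem_filter.1 ha
    refine Finset.mem_filter.2 ⟨hb, fun hxb => ?_, fun hyb => ?_⟩
    · exact hya (hP a has b hb x hx y hy hab hxb.symm hxy (fun e => hxa e.symm)
        (hT x hx b hb y hy hxb hxy)).symm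
    · exact hxa (hP a has b hb y hy x hx hab hyb.symm hxy.symm (fun e => hya e.symm)
        (hT y hy b hb x hx hyb hxy.symm)).symm
  refine ⟨fun z => if G.Adj x z then 0 else if G.Adj y z then 1 else f z, ?_, ?_⟩
  · intro z hz
    by_cases hz' : z ∈ t
    · have := f1 z hz'
      grind
    · grind
  · intro a ha b hb hab
    have h1 := hT x hx a ha b hb
    have h2 := hT y hy a ha b hb
    have h3 := hcut a
    have h4 := hcut b
    have h5 := f2 a
    have := hab.symm
    have hmem : ∀ z ∈ s, (z ∈ t ↔ ¬ G.Adj x z ∧ ¬ G.Adj y z) := fun z hz => by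
      simp [t, hz]
    have := hmem a ha
    have := hmem b hb
    grind

end Coloring

section Recoloring

variable {V : Type*} {G : SimpleGraph V}

theorem exists_injOn_of_card_le {S T : Finset ℕ} (h : S.card ≤ T.card) :
    ∃ e : ℕ → ℕ, (∀ x ∈ S, e x ∈ T) ∧ ∀ x ∈ S, ∀ y ∈ S, e x = e y → x = y := by
  obtain ⟨U, hU, hc⟩ := Finset.exists_subset_card_eq h
  let e := Finset.equivOfCardEq hc.symm
  refine ⟨fun x => if hx : x ∈ S then e ⟨x, hx⟩ else 0, ?_, ?_⟩
  · intro x hx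
    simpa [hx] using hU (e ⟨x, hx⟩).2
  · intro x hx y hy hxy
    simp only [hx, hy, dif_pos] at hxy
    simpa using e.injective (Subtype.ext hxy)

/-- The complement of `G` restricted to `A`, as a graph on all of `V`. -/
def coGraph (G : SimpleGraph V) (A : Set V) : SimpleGraph V where
  Adj x y := x ∈ A ∧ y ∈ A ∧ x ≠ y ∧ ¬ G.Adj x y
  symm := ⟨fun _ _ h => ⟨h.2.1, h.1, h.2.2.1.symm, fun e => h.2.2.2 e.symm⟩⟩
  loopless := ⟨fun _ h => h.2.2.1 rfl⟩

theorem iff_of_reachable {H : SimpleGraph V} {P : V → Prop} {x y : V} (h : H.Reachable x y)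
    (hP : ∀ a b, H.Adj a b → (P a ↔ P b)) : P x ↔ P y := by
  obtain ⟨p⟩ := h
  induction p with
  | nil => rfl
  | cons hab _ ih => exact (hP _ _ hab).trans ih

/-- If non-adjacent vertices of `A` have the same neighbours in `B`, then a colouring of `A ∪ B`
can be changed so that it uses on `A` at most as many colours as a given colouring of `A`. -/
theorem exists_coloring_image_card_le [DecidableEq V] {A B : Finset V} {n : ℕ} {f : V → ℕ}
    (hmod : ∀ x ∈ A, ∀ y ∈ A, x ≠ y → ¬ G.Adj x y → ∀ b ∈ B, (G.Adj b x ↔ G.Adj b y))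
    (hf : ∀ x ∈ A, ∀ y ∈ A, G.Adj x y → f x ≠ f y) (hg : ColorableOn G (A ∪ B) n) :
    ∃ g : V → ℕ, (∀ x ∈ A ∪ B, g x < n) ∧
      (∀ x ∈ A ∪ B, ∀ y ∈ A ∪ B, G.Adj x y → g x ≠ g y) ∧
      (A.image g).card ≤ (A.image f).card := by
  classical
  obtain ⟨g, g1, g2⟩ := hg
  let H := coGraph G (A : Set V)
  let cl : H.ConnectedComponent → Finset V := fun c =>
    A.filter fun x => H.connectedComponentMk x = c
  have mem_cl : ∀ {c x}, x ∈ cl c ↔ x ∈ A ∧ H.connectedComponentMk x = c := by simp [cl]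
  have adj_of_ne : ∀ {x y}, x ∈ A → y ∈ A →
      H.connectedComponentMk x ≠ H.connectedComponentMk y → G.Adj x y := by
    intro x y hx hy hne
    by_contra hxy
    refine hne (SimpleGraph.ConnectedComponent.eq.2 (SimpleGraph.Adj.reachable ?_))
    exact ⟨hx, hy, fun e => hne (e ▸ rfl), hxy⟩
  have adj_iff : ∀ {x y b}, H.connectedComponentMk x = H.connectedComponentMk y → b ∈ B →
      (G.Adj b x ↔ G.Adj b y) := by
    intro x y b hxy hb
    exact iff_of_reachable (P := fun z => G.Adj b z) (SimpleGraph.ConnectedComponent.eq.1 hxy)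
      fun a c hac => hmod a hac.1 c hac.2.1 hac.2.2.1 hac.2.2.2 b hb
  have hφ : ∀ c, ∃ φ : V → ℕ, (∀ x ∈ cl c, φ x ∈ (cl c).image g) ∧
      (∀ x ∈ cl c, ∀ y ∈ cl c, G.Adj x y → φ x ≠ φ y) ∧
      ((cl c).image φ).card ≤ ((cl c).image f).card := by
    intro c
    rcases le_total ((cl c).image g).card ((cl c).image f).card with hle | hle
    · refine ⟨g, fun x hx => Finset.mem_image_of_mem g hx, fun x hx y hy => ?_, hle⟩
      exact g2 x (Finset.mem_union_left _ (mem_cl.1 hx).1) y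
        (Finset.mem_union_left _ (mem_cl.1 hy).1)
    · obtain ⟨e, e1, e2⟩ := exists_injOn_of_card_le hle
      refine ⟨e ∘ f, fun x hx => e1 _ (Finset.mem_image_of_mem f hx), ?_, ?_⟩
      · intro x hx y hy hxy hh
        exact hf x (mem_cl.1 hx).1 y (mem_cl.1 hy).1 hxy
          (e2 _ (Finset.mem_image_of_mem f hx) _ (Finset.mem_image_of_mem f hy) hh)
      · rw [← Finset.image_image]
        exact Finset.card_image_le
  choose φ φ1 φ2 φ3 using hφ
  have φg : ∀ x ∈ A, ∃ z ∈ A, H.connectedComponentMk z = H.connectedComponentMk x ∧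
      g z = φ (H.connectedComponentMk x) x := by
    intro x hx
    obtain ⟨z, hz, hgz⟩ := Finset.mem_image.1 (φ1 _ x (mem_cl.2 ⟨hx, rfl⟩))
    exact ⟨z, (mem_cl.1 hz).1, (mem_cl.1 hz).2, hgz⟩
  let g' : V → ℕ := fun x => if x ∈ A then φ (H.connectedComponentMk x) x else g x
  have g'A : ∀ x ∈ A, g' x = φ (H.connectedComponentMk x) x := fun x hx => if_pos hx
  have g'B : ∀ x ∉ A, g' x = g x := fun x hx => if_neg hx
  have cross : ∀ x ∈ A, ∀ y ∈ A ∪ B, y ∉ A → G.Adj x y → g' x ≠ g' y := by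
    intro x hx y hyAB hyA hxy
    obtain ⟨z, hz, hzx, hgz⟩ := φg x hx
    rw [g'A x hx, g'B y hyA, ← hgz]
    have hyB : y ∈ B := (Finset.mem_union.1 hyAB).resolve_left hyA
    exact g2 z (Finset.mem_union_left _ hz) y hyAB ((adj_iff hzx hyB).2 hxy.symm).symm
  refine ⟨g', ?_, ?_, ?_⟩
  · intro x hx
    by_cases hxA : x ∈ A
    · obtain ⟨z, hz, -, hgz⟩ := φg x hxA
      rw [g'A x hxA, ← hgz]
      exact g1 z (Finset.mem_union_left _ hz)
    · rw [g'B x hxA]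
      exact g1 x hx
  · intro x hx y hy hxy
    by_cases hxA : x ∈ A <;> by_cases hyA : y ∈ A
    · by_cases hc : H.connectedComponentMk x = H.connectedComponentMk y
      · rw [g'A x hxA, g'A y hyA, hc]
        exact φ2 _ x (mem_cl.2 ⟨hxA, hc⟩) y (mem_cl.2 ⟨hyA, rfl⟩) hxy
      · obtain ⟨z, hz, hzx, hgz⟩ := φg x hxA
        obtain ⟨u, hu, huy, hgu⟩ := φg y hyA
        rw [g'A x hxA, g'A y hyA, ← hgz, ← hgu]
        exact g2 z (Finset.mem_union_left _ hz) u (Finset.mem_union_left _ hu)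
          (adj_of_ne hz hu (by rwa [hzx, huy]))
    · exact cross x hxA y hy hyA hxy
    · exact (cross y hyA x hx hxA hxy.symm).symm
    · rw [g'B x hxA, g'B y hyA]
      exact g2 x hx y hy hxy
  · let I := A.image H.connectedComponentMk
    have himg : ∀ h : V → ℕ, A.image h = I.biUnion fun c => (cl c).image h := by
      intro h
      ext k
      simp only [I, Finset.mem_image, Finset.mem_biUnion, mem_cl]
      constructor
      · rintro ⟨x, hx, rfl⟩
        exact ⟨_, ⟨x, hx, rfl⟩, x, ⟨hx, rfl⟩, rfl⟩
      · rintro ⟨_, -, x, ⟨hx, -⟩, rfl⟩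
        exact ⟨x, hx, rfl⟩
    have hdisj : ∀ c ∈ I, ∀ c' ∈ I, c ≠ c' →
        Disjoint ((cl c).image f) ((cl c').image f) := by
      intro c _ c' _ hne
      rw [Finset.disjoint_left]
      intro k hk hk'
      obtain ⟨x, hx, rfl⟩ := Finset.mem_image.1 hk
      obtain ⟨y, hy, hxy⟩ := Finset.mem_image.1 hk'
      obtain ⟨hxA, rfl⟩ := mem_cl.1 hx
      obtain ⟨hyA, rfl⟩ := mem_cl.1 hy
      exact hf x hxA y hyA (adj_of_ne hxA hyA hne) hxy.symm
    calc (A.image g').card ≤ ∑ c ∈ I, ((cl c).image g').card := by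
          rw [himg]
          exact Finset.card_biUnion_le
      _ ≤ ∑ c ∈ I, ((cl c).image f).card := by
          refine Finset.sum_le_sum fun c _ => ?_
          have : (cl c).image g' = (cl c).image (φ c) := by
            refine Finset.image_congr fun x hx => ?_
            obtain ⟨hxA, rfl⟩ := mem_cl.1 (Finset.mem_coe.1 hx)
            exact g'A x hxA
          rw [this]
          exact φ3 c
      _ = (A.image f).card := by
          rw [himg, Finset.card_biUnion hdisj]

theorem exists_clique_cliqueBound (G : SimpleGraph V) (A : Finset V) :
    ∃ Q ⊆ A, G.IsClique (Q : Set V) ∧ CliqueBound G A Q.card := by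
  classical
  obtain ⟨Q, hQ, hmax⟩ := (A.powerset.filter fun (Q : Finset V) => G.IsClique (Q : Set V)).exists_max_image
    Finset.card ⟨∅, by simp⟩
  obtain ⟨h1, h2⟩ := Finset.mem_filter.1 hQ
  exact ⟨Q, Finset.mem_powerset.1 h1, h2, fun t ht hc =>
    hmax t (Finset.mem_filter.2 ⟨Finset.mem_powerset.2 ht, hc⟩)⟩

/-- Hall's theorem for a relation between two finsets. -/
theorem exists_injection_of_hall {S T : Finset V} (R : V → V → Prop)
    [DecidableRel R] (h : ∀ U ⊆ S, U.card ≤ (T.filter fun y => ∃ x ∈ U, R x y).card) :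
    ∃ φ : V → V, (∀ x ∈ S, φ x ∈ T) ∧ (∀ x ∈ S, ∀ y ∈ S, φ x = φ y → x = y) ∧
      ∀ x ∈ S, R x (φ x) := by
  classical
  obtain ⟨f, hinj, hf⟩ := (Finset.all_card_le_biUnion_card_iff_exists_injective
    fun x : S => T.filter fun y => R x y).1 (by
      intro U
      have := h (U.map (Function.Embedding.subtype _)) (by
        intro x hx
        obtain ⟨y, -, rfl⟩ := Finset.mem_map.1 hx
        exact y.2)
      rw [Finset.card_map] at this
      refine this.trans (Finset.card_le_card ?_)
      intro y hy
      simp only [Finset.mem_filter, Finset.mem_map] at hy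
      obtain ⟨hyT, _, ⟨x, hx, rfl⟩, hR⟩ := hy
      exact Finset.mem_biUnion.2 ⟨x, hx, Finset.mem_filter.2 ⟨hyT, hR⟩⟩)
  refine ⟨fun x => if hx : x ∈ S then f ⟨x, hx⟩ else x, ?_, ?_, ?_⟩
  · intro x hx
    simpa [hx] using (Finset.mem_filter.1 (hf ⟨x, hx⟩)).1
  · intro x hx y hy hxy
    simp only [hx, hy, dif_pos] at hxy
    simpa using hinj hxy
  · intro x hx
    simpa [hx] using (Finset.mem_filter.1 (hf ⟨x, hx⟩)).2

end Recoloring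

/-- A graph violating Reed's bound for the bounds `d` on the maximum degree and `w` on the clique
number, all of whose proper induced subgraphs satisfy Reed's bound. -/
structure MinimalCounterexample {V : Type*} [Fintype V] (G : SimpleGraph V) (d w : ℕ) :
    Prop where
  noP4K1 : NoP4K1 G
  noKite : NoKite G
  degreeBound : DegreeBound G Finset.univ d
  cliqueBound : CliqueBound G Finset.univ w
  not_colorable : ¬ ColorableOn G Finset.univ ((d + w + 2) / 2)
  reedOn : ∀ t : Finset V, t ≠ Finset.univ → ReedOn G t

namespace MinimalCounterexample

variable {V : Type*} [Fintype V] {G : SimpleGraph V} {d w : ℕ}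

theorem colorableOn (h : MinimalCounterexample G d w) {t : Finset V} (ht : t ≠ Finset.univ) :
    ColorableOn G t ((d + w + 2) / 2) :=
  h.reedOn t ht d w
    (fun x _ s _ hxs => h.degreeBound x (Finset.mem_univ x) s (Finset.subset_univ s) hxs)
    (fun s _ hs => h.cliqueBound s (Finset.subset_univ s) hs)

theorem erase_ne_univ [DecidableEq V] (v : V) :
    (Finset.univ.erase v : Finset V) ≠ Finset.univ := fun e =>
  Finset.notMem_erase v Finset.univ (by rw [e]; exact Finset.mem_univ v)

theorem no_dominated (h : MinimalCounterexample G d w) {x y : V} (hne : x ≠ y)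
    (hdom : ∀ u, G.Adj x u → G.Adj y u) : False := by
  classical
  obtain ⟨f, f1, f2⟩ := h.colorableOn (erase_ne_univ x)
  have f1' : ∀ z, z ≠ x → f z < (d + w + 2) / 2 := fun z hz => f1 z (by simp [hz])
  have f2' : ∀ a b, a ≠ x → b ≠ x → G.Adj a b → f a ≠ f b := fun a b ha hb =>
    f2 a (by simp [ha]) b (by simp [hb])
  refine h.not_colorable ⟨fun z => if z = x then f y else f z, ?_, ?_⟩
  · intro z _
    grind
  · intro a _ b _ hab
    have := hab.symm
    have := hab.ne
    grind [SimpleGraph.Adj.symm]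

theorem card_neighbors_ge (h : MinimalCounterexample G d w) {v : V} {N : Finset V}
    (hN : ∀ u, G.Adj v u → u ∈ N) : (d + w + 2) / 2 ≤ N.card := by
  classical
  by_contra! hlt
  obtain ⟨f, f1, f2⟩ := h.colorableOn (erase_ne_univ v)
  have f1' : ∀ z, z ≠ v → f z < (d + w + 2) / 2 := fun z hz => f1 z (by simp [hz])
  have f2' : ∀ a b, a ≠ v → b ≠ v → G.Adj a b → f a ≠ f b := fun a b ha hb =>
    f2 a (by simp [ha]) b (by simp [hb])
  obtain ⟨c, hc, hcN⟩ := Finset.exists_mem_notMem_of_card_lt_card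
    (s := N.image f) (t := Finset.range ((d + w + 2) / 2))
    (by rw [Finset.card_range]; exact Finset.card_image_le.trans_lt hlt)
  have hcN' : ∀ u, G.Adj v u → f u ≠ c := fun u hu e =>
    hcN (Finset.mem_image.2 ⟨u, hN u hu, e⟩)
  have hc' := Finset.mem_range.1 hc
  refine h.not_colorable ⟨fun z => if z = v then c else f z, ?_, ?_⟩
  · intro z _
    grind
  · intro a _ b _ hab
    have := hab.symm
    have := hab.ne
    grind

/-- The graph is not the join of two nonempty graphs. -/
theorem not_join [DecidableEq V] (h : MinimalCounterexample G d w) {M A : Finset V} {x : V}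
    (hx : x ∈ M) (hM : M ≠ Finset.univ) (hMA : M ∪ A = Finset.univ) (hdisj : Disjoint M A)
    (hadj : ∀ a ∈ A, ∀ m ∈ M, G.Adj m a) : False := by
  obtain ⟨Q, hQA, hQ, hQb⟩ := exists_clique_cliqueBound G A
  have hAd : A.card ≤ d := h.degreeBound x (Finset.mem_univ x) A (Finset.subset_univ A)
    fun a ha => hadj a ha x hx
  have hQw : Q.card ≤ w := h.cliqueBound Q (Finset.subset_univ Q) hQ
  have h1 : ColorableOn G M ((d - A.card + (w - Q.card) + 2) / 2) := by
    refine h.reedOn M hM _ _ ?_ ?_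
    · intro m hm s hs hms
      have := h.degreeBound m (Finset.mem_univ m) (s ∪ A) (Finset.subset_univ _) (by
        intro y hy
        rcases Finset.mem_union.1 hy with hy | hy
        · exact hms y hy
        · exact hadj y hy m hm)
      rw [Finset.card_union_of_disjoint (hdisj.mono_left hs)] at this
      omega
    · intro s hs hsc
      have := h.cliqueBound (s ∪ Q) (Finset.subset_univ _) (by
        intro a ha b hb hab
        simp only [Finset.coe_union, Set.mem_union, Finset.mem_coe] at ha hb
        rcases ha with ha | ha <;> rcases hb with hb | hb
        · exact hsc ha hb hab
        · exact hadj b (hQA hb) a (hs ha)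
        · exact (hadj a (hQA ha) b (hs hb)).symm
        · exact hQ ha hb hab)
      rw [Finset.card_union_of_disjoint (hdisj.mono hs hQA)] at this
      omega
  have h2 := h1.union (colorableOn_half hQb)
  rw [hMA] at h2
  exact h.not_colorable (h2.mono subset_rfl (by omega))

/-- There is no nontrivial homogeneous set containing an edge. -/
theorem no_module_with_edge (h : MinimalCounterexample G d w) {M : Finset V} {p q : V}
    (hmod : ∀ u ∉ M, ∀ x ∈ M, ∀ y ∈ M, (G.Adj u x ↔ G.Adj u y)) (hp : p ∈ M) (hq : q ∈ M)
    (hpq : G.Adj p q) (hM : M ≠ Finset.univ) : False := by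
  classical
  let A := Finset.univ.filter fun u => u ∉ M ∧ G.Adj u p
  let B := Finset.univ.filter fun u => u ∉ M ∧ ¬ G.Adj u p
  have mA : ∀ {u}, u ∈ A ↔ u ∉ M ∧ G.Adj u p := by simp [A]
  have mB : ∀ {u}, u ∈ B ↔ u ∉ M ∧ ¬ G.Adj u p := by simp [B]
  have hAM : ∀ a ∈ A, ∀ m ∈ M, G.Adj m a := fun a ha m hm =>
    ((hmod a (mA.1 ha).1 m hm p hp).2 (mA.1 ha).2).symm
  have hBM : ∀ b ∈ B, ∀ m ∈ M, ¬ G.Adj b m := fun b hb m hm e =>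
    (mB.1 hb).2 ((hmod b (mB.1 hb).1 m hm p hp).1 e)
  have hdisj : Disjoint M A := Finset.disjoint_left.2 fun x hx hxA => (mA.1 hxA).1 hx
  by_cases hB : B = ∅
  · refine h.not_join hp hM ?_ hdisj hAM
    ext u
    simp only [Finset.mem_union, Finset.mem_univ, iff_true]
    by_contra! hu
    have : u ∈ B := mB.2 ⟨hu.1, fun e => hu.2 (mA.2 ⟨hu.1, e⟩)⟩
    simp [hB] at this
  obtain ⟨b, hb⟩ := Finset.nonempty_iff_ne_empty.2 hB
  obtain ⟨f, f1, f2⟩ := h.colorableOn (t := M ∪ A) fun e => by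
    have : b ∈ M ∪ A := e ▸ Finset.mem_univ b
    rcases Finset.mem_union.1 this with h1 | h1
    · exact (mB.1 hb).1 h1
    · exact (mB.1 hb).2 (mA.1 h1).2
  obtain ⟨g, g1, g2, g3⟩ := exists_coloring_image_card_le (G := G) (A := A) (B := B) (f := f)
    (n := (d + w + 2) / 2)
    (by
      have key : ∀ x ∈ A, ∀ y ∈ A, ¬ G.Adj x y → ∀ b ∈ B, G.Adj b x → G.Adj b y := by
        intro x hx y hy hxy b hb hbx
        by_contra hby
        exact h.noKite p q x y b hpq (hAM x hx p hp) (hAM x hx q hq) (hAM y hy p hp)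
          (hAM y hy q hq) hbx.symm hxy (fun e => hBM b hb p hp e.symm)
          (fun e => hBM b hb q hq e.symm) (fun e => hby e.symm)
      exact fun x hx y hy _ hxy b hb =>
        ⟨key x hx y hy hxy b hb, key y hy x hx (fun e => hxy e.symm) b hb⟩)
    (fun x hx y hy => f2 x (Finset.mem_union_right _ hx) y (Finset.mem_union_right _ hy))
    (h.colorableOn fun e => by
      have : p ∈ A ∪ B := e ▸ Finset.mem_univ p
      rcases Finset.mem_union.1 this with h1 | h1
      · exact (mA.1 h1).1 hp
      · exact (mB.1 h1).1 hp)
  have hfd : Disjoint (M.image f) (A.image f) := by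
    rw [Finset.disjoint_left]
    intro k hk hk'
    obtain ⟨m, hm, rfl⟩ := Finset.mem_image.1 hk
    obtain ⟨a, ha, hma⟩ := Finset.mem_image.1 hk'
    exact f2 m (Finset.mem_union_left _ hm) a (Finset.mem_union_right _ ha) (hAM a ha m hm)
      hma.symm
  have hcard : (M.image f).card ≤ (Finset.range ((d + w + 2) / 2) \ A.image g).card := by
    have h1 : (M.image f ∪ A.image f).card ≤ (Finset.range ((d + w + 2) / 2)).card := by
      refine Finset.card_le_card fun k hk => ?_
      rw [← Finset.image_union] at hk
      obtain ⟨x, hx, rfl⟩ := Finset.mem_image.1 hk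
      exact Finset.mem_range.2 (f1 x hx)
    rw [Finset.card_union_of_disjoint hfd] at h1
    have h2 := Finset.le_card_sdiff (A.image g) (Finset.range ((d + w + 2) / 2))
    omega
  obtain ⟨e, e1, e2⟩ := exists_injOn_of_card_le hcard
  have eM : ∀ m ∈ M, e (f m) < (d + w + 2) / 2 ∧ ∀ a ∈ A, g a ≠ e (f m) := by
    intro m hm
    have := Finset.mem_sdiff.1 (e1 _ (Finset.mem_image_of_mem f hm))
    exact ⟨Finset.mem_range.1 this.1, fun a ha hh =>
      this.2 (Finset.mem_image.2 ⟨a, ha, hh⟩)⟩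
  have split : ∀ x, x ∉ M → x ∈ A ∪ B := fun x hx => by
    by_cases hxp : G.Adj x p
    · exact Finset.mem_union_left _ (mA.2 ⟨hx, hxp⟩)
    · exact Finset.mem_union_right _ (mB.2 ⟨hx, hxp⟩)
  have cross : ∀ x ∈ M, ∀ y, y ∉ M → G.Adj x y → g y ≠ e (f x) := by
    intro x hx y hy hxy
    refine (eM x hx).2 y (mA.2 ⟨hy, ?_⟩)
    exact (hmod y hy x hx p hp).1 hxy.symm
  refine h.not_colorable ⟨fun z => if z ∈ M then e (f z) else g z, ?_, ?_⟩
  · intro z _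
    by_cases hz : z ∈ M
    · simpa [hz] using (eM z hz).1
    · simpa [hz] using g1 z (split z hz)
  · intro x _ y _ hxy
    by_cases hx : x ∈ M <;> by_cases hy : y ∈ M <;> simp only [hx, hy, if_true, if_false]
    · intro hh
      exact f2 x (Finset.mem_union_left _ hx) y (Finset.mem_union_left _ hy) hxy
        (e2 _ (Finset.mem_image_of_mem f hx) _ (Finset.mem_image_of_mem f hy) hh)
    · exact (cross x hx y hy hxy).symm
    · exact cross y hy x hx hxy.symm
    · exact g2 x (split x hx) y (split y hy) hxy

/-- There is no nontrivial homogeneous set. -/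
theorem no_module (h : MinimalCounterexample G d w) {M : Finset V} {x y : V}
    (hmod : ∀ u ∉ M, ∀ x ∈ M, ∀ y ∈ M, (G.Adj u x ↔ G.Adj u y)) (hx : x ∈ M) (hy : y ∈ M)
    (hxy : x ≠ y) (hM : M ≠ Finset.univ) : False := by
  by_cases hE : ∃ p ∈ M, ∃ q ∈ M, G.Adj p q
  · obtain ⟨p, hp, q, hq, hpq⟩ := hE
    exact h.no_module_with_edge hmod hp hq hpq hM
  · push Not at hE
    refine h.no_dominated hxy fun u hu => ?_
    have huM : u ∉ M := fun huM => hE x hx u huM hu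
    exact ((hmod u huM x hx y hy).1 hu.symm).symm

/-- Every vertex is anticomplete to some triangle. -/
theorem exists_triangle (h : MinimalCounterexample G d w) (v : V) :
    ∃ a b c, G.Adj a b ∧ G.Adj a c ∧ G.Adj b c ∧ ¬ G.Adj v a ∧ ¬ G.Adj v b ∧ ¬ G.Adj v c := by
  classical
  by_contra! hno
  let N := Finset.univ.filter fun u => G.Adj v u
  let S := Finset.univ.filter fun u => ¬ G.Adj v u
  have mN : ∀ {u}, u ∈ N ↔ G.Adj v u := by simp [N]
  have mS : ∀ {u}, u ∈ S ↔ ¬ G.Adj v u := by simp [S]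
  have hS : ColorableOn G S 2 := by
    refine colorableOn_two ?_ ?_
    · intro a ha b hb c hc hab hac hbc
      exact mS.1 hc (hno a b c hab hac hbc (mS.1 ha) (mS.1 hb))
    · intro a ha b hb c hc e he hab hbc hce hac hbe
      by_contra hae
      exact h.noP4K1 a b c e v hab hbc hce hac hae hbe (mS.1 ha) (mS.1 hb) (mS.1 hc) (mS.1 he)
  have hNd : N.card ≤ d := h.degreeBound v (Finset.mem_univ v) N (Finset.subset_univ N)
    fun y hy => mN.1 hy
  have hNw : ∀ t ⊆ N, G.IsClique (t : Set V) → t.card + 1 ≤ w := by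
    intro t ht htc
    have := h.cliqueBound (insert v t) (Finset.subset_univ _) (by
      rw [Finset.coe_insert, SimpleGraph.isClique_insert]
      exact ⟨htc, fun b hb _ => mN.1 (ht hb)⟩)
    rwa [Finset.card_insert_of_notMem fun hv => (mN.1 (ht hv)).ne rfl] at this
  by_cases hNc : G.IsClique (N : Set V)
  · have h1 := h.card_neighbors_ge (v := v) (N := N) fun u hu => mN.2 hu
    have h2 := hNw N subset_rfl hNc
    omega
  · have hne : N.Nonempty := by
      rw [Finset.nonempty_iff_ne_empty]
      intro e
      simp [e] at hNc
    obtain ⟨u, hu⟩ := hne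
    have hw2 := hNw {u} (Finset.singleton_subset_iff.2 hu) (by simp)
    rw [Finset.card_singleton] at hw2
    have hc := (colorableOn_half_of_not_isClique (w := w - 1)
      (fun t ht htc => by have := hNw t ht htc; omega) hNc).union hS
    have huniv : N ∪ S = Finset.univ := by
      ext u
      simp [N, S, em]
    rw [huniv] at hc
    exact h.not_colorable (hc.mono subset_rfl (by omega))

/-- No vertex is anticomplete to a diamond. -/
theorem noDiamond (h : MinimalCounterexample G d w) (v a b c e : V) (va : ¬ G.Adj v a)
    (vb : ¬ G.Adj v b) (vc : ¬ G.Adj v c) (ve : ¬ G.Adj v e) (ab : G.Adj a b) (ac : G.Adj a c)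
    (bc : G.Adj b c) (ae : G.Adj a e) (be : G.Adj b e) (hce : c ≠ e) : G.Adj c e := by
  classical
  by_contra nce
  let W : Set V := {u | G.Adj a u ∧ G.Adj b u ∧ ¬ G.Adj v u}
  let H := coGraph G W
  have cW : c ∈ W := ⟨ac, bc, vc⟩
  have eW : e ∈ W := ⟨ae, be, ve⟩
  let Y := Finset.univ.filter fun u => H.Reachable c u
  have mY : ∀ {u}, u ∈ Y ↔ H.Reachable c u := by simp [Y]
  have YW : ∀ u ∈ Y, u ∈ W := fun u hu =>
    (iff_of_reachable (P := fun z => z ∈ W) (mY.1 hu)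
      fun x y hxy => ⟨fun _ => hxy.2.1, fun _ => hxy.1⟩).1 cW
  have key : ∀ u, u ∉ W → ∀ x y, H.Adj x y → G.Adj u x → G.Adj u y := by
    rintro u huW x y ⟨⟨ax, bx, vx⟩, ⟨ay, b_y, vy⟩, hne, nxy⟩ ux
    by_contra uy
    have yu : ¬ G.Adj y u := fun e => uy e.symm
    have av : ¬ G.Adj a v := fun e => va e.symm
    have bv : ¬ G.Adj b v := fun e => vb e.symm
    have xv : ¬ G.Adj x v := fun e => vx e.symm
    have yv : ¬ G.Adj y v := fun e => vy e.symm
    by_cases ua : G.Adj u a <;> by_cases ub : G.Adj u b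
    · by_cases vu : G.Adj v u
      · exact h.noKite a b u y v ab ua.symm ub.symm ay b_y vu.symm uy av bv yv
      · exact huW ⟨ua.symm, ub.symm, vu⟩
    · by_cases vu : G.Adj v u
      · exact h.noKite a x u b v ax ua.symm ux.symm ab bx.symm vu.symm ub av xv bv
      · exact h.noP4K1 u x b y v ux bx.symm b_y ub uy nxy vu vx vb vy
    · by_cases vu : G.Adj v u
      · exact h.noKite b x u a v bx ub.symm ux.symm ab.symm ax.symm vu.symm ua bv xv av
      · exact h.noP4K1 u x a y v ux ax.symm ay ua uy nxy vu vx va vy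
    · exact h.noKite a b x y u ab ax bx ay b_y ux.symm nxy (fun e => ua e.symm)
        (fun e => ub e.symm) yu
  refine h.no_module (M := Y) (x := c) (y := e) ?_ (mY.2 (SimpleGraph.Reachable.refl c))
    (mY.2 (SimpleGraph.Adj.reachable ⟨cW, eW, hce, nce⟩)) hce ?_
  · intro u hu
    have base : ∀ x ∈ Y, G.Adj u c ↔ G.Adj u x := by
      intro x hx
      by_cases huW : u ∈ W
      · have full : ∀ z ∈ Y, G.Adj u z := by
          intro z hz
          by_contra huz
          refine hu (mY.2 ((mY.1 hz).trans (SimpleGraph.Adj.reachable ?_)))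
          exact ⟨YW z hz, huW, fun e => hu (e ▸ hz), fun e => huz e.symm⟩
        exact ⟨fun _ => full x hx, fun _ => full c (mY.2 (SimpleGraph.Reachable.refl c))⟩
      · exact iff_of_reachable (P := fun z => G.Adj u z) (mY.1 hx) fun x y hxy =>
          ⟨key u huW x y hxy, key u huW y x hxy.symm⟩
    exact fun x hx y hy => (base x hx).symm.trans (base y hy)
  · intro e
    have : a ∈ Y := e ▸ Finset.mem_univ a
    exact (YW a this).1.ne rfl

theorem noTwins (h : MinimalCounterexample G d w) (x y : V) (hxy : G.Adj x y) :
    ∃ u, u ≠ x ∧ u ≠ y ∧ (G.Adj u x ∧ ¬ G.Adj u y ∨ ¬ G.Adj u x ∧ G.Adj u y) := by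
  classical
  by_contra! hno
  refine h.no_module (M := {x, y}) (x := x) (y := y) ?_ (by simp) (by simp) hxy.ne ?_
  · intro u hu p hp q hq
    have hu' : u ≠ x ∧ u ≠ y := by simpa using hu
    have h1 := hno u hu'.1 hu'.2
    simp only [Finset.mem_insert, Finset.mem_singleton] at hp hq
    rcases hp with rfl | rfl <;> rcases hq with rfl | rfl <;> tauto
  · intro e
    obtain ⟨a, b, -, ab, -, -, xa, xb, -⟩ := h.exists_triangle x
    have ha : a ∈ ({x, y} : Finset V) := e ▸ Finset.mem_univ a
    simp only [Finset.mem_insert, Finset.mem_singleton] at ha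
    rcases ha with rfl | rfl
    · exact xb ab
    · exact xa hxy

theorem obstruction (h : MinimalCounterexample G d w) : Obstruction G where
  noP4K1 := h.noP4K1
  noKite := h.noKite
  exists_triangle := h.exists_triangle
  noDiamond := h.noDiamond
  noTwins := h.noTwins

end MinimalCounterexample

section Hall

variable {V : Type*} {G : SimpleGraph V} {K D : Finset V}

/-- If every vertex of `D` has at most one neighbour in `K` and no vertex of `K` is complete to
`D`, then `K ∪ D` can be coloured with `max K.card D.card` colours. -/
theorem colorableOn_union_max [DecidableEq V]
    (huniq : ∀ u ∈ D, ∀ k ∈ K, ∀ l ∈ K, G.Adj u k → G.Adj u l → k = l)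
    (hmiss : ∀ k ∈ K, ∃ u ∈ D, ¬ G.Adj k u) : ColorableOn G (K ∪ D) (max K.card D.card) := by
  classical
  rcases le_or_gt K.card D.card with hle | hlt
  · obtain ⟨φ, h1, h2, h3⟩ := exists_injection_of_hall (S := K) (T := D)
      (fun k u => ¬ G.Adj k u) (by
        intro U hU
        rcases le_or_gt U.card 1 with h1 | h1
        · rcases U.eq_empty_or_nonempty with rfl | ⟨k, hk⟩
          · simp
          · obtain ⟨u, hu, hku⟩ := hmiss k (hU hk)
            exact h1.trans (Finset.card_pos.2 ⟨u, Finset.mem_filter.2 ⟨hu, k, hk, hku⟩⟩)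
        · obtain ⟨k, hk, l, hl, hkl⟩ := Finset.one_lt_card.1 h1
          refine (Finset.card_le_card hU).trans (hle.trans (Finset.card_le_card fun u hu => ?_))
          refine Finset.mem_filter.2 ⟨hu, ?_⟩
          by_contra! hall
          exact hkl (huniq u hu k (hU hk) l (hU hl) (hall k hk).symm (hall l hl).symm))
    exact (colorableOn_union_of_injection φ h1 h2 h3).mono subset_rfl (le_max_right _ _)
  · obtain ⟨φ, h1, h2, h3⟩ := exists_injection_of_hall (S := D) (T := K)
      (fun u k => ¬ G.Adj u k) (by
        intro U hU
        rcases U.eq_empty_or_nonempty with rfl | ⟨u, hu⟩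
        · simp
        · have hone : (K.filter fun k => G.Adj u k).card ≤ 1 :=
            Finset.card_le_one.2 fun k hk l hl => huniq u (hU hu) k (Finset.mem_filter.1 hk).1 l
              (Finset.mem_filter.1 hl).1 (Finset.mem_filter.1 hk).2 (Finset.mem_filter.1 hl).2
          have hsum := Finset.card_filter_add_card_filter_not (s := K) fun k => G.Adj u k
          have hsub : (K.filter fun k => ¬ G.Adj u k).card ≤
              (K.filter fun k => ∃ x ∈ U, ¬ G.Adj x k).card :=
            Finset.card_le_card fun k hk => Finset.mem_filter.2
              ⟨(Finset.mem_filter.1 hk).1, u, hu, (Finset.mem_filter.1 hk).2⟩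
          have := Finset.card_le_card hU
          omega)
    have := colorableOn_union_of_injection φ h1 h2 h3
    rw [Finset.union_comm] at this
    exact this.mono subset_rfl (le_max_left _ _)

/-- If every vertex of `D` has at most one neighbour in `K`, some vertex of `D` has none, and
every vertex of `K` has at most `K.card` non-neighbours in `D`, then `D.card ≤ K.card + 1`. -/
theorem card_le_of_unique_neighbor [DecidableRel G.Adj]
    (huniq : ∀ u ∈ D, ∀ k ∈ K, ∀ l ∈ K, G.Adj u k → G.Adj u l → k = l)
    (hnon : ∀ k ∈ K, (D.filter fun u => ¬ G.Adj k u).card ≤ K.card) {v : V} (hv : v ∈ D)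
    (hvK : ∀ k ∈ K, ¬ G.Adj v k) (hK : 2 ≤ K.card) : D.card ≤ K.card + 1 := by
  classical
  have h1 : ∑ k ∈ K, (D.filter fun u => G.Adj k u).card ≤ (D.erase v).card := by
    rw [← Finset.card_biUnion]
    · refine Finset.card_le_card fun u hu => ?_
      obtain ⟨k, hk, hu⟩ := Finset.mem_biUnion.1 hu
      obtain ⟨huD, hku⟩ := Finset.mem_filter.1 hu
      exact Finset.mem_erase.2 ⟨fun e => hvK k hk (e ▸ hku.symm), huD⟩
    · intro k hk l hl hkl
      refine Finset.disjoint_left.2 fun u hu hu' => hkl ?_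
      obtain ⟨huD, hku⟩ := Finset.mem_filter.1 hu
      exact huniq u huD k hk l hl hku.symm (Finset.mem_filter.1 hu').2.symm
  have h2 : ∑ _k ∈ K, D.card ≤ ∑ k ∈ K, ((D.filter fun u => G.Adj k u).card + K.card) := by
    refine Finset.sum_le_sum fun k hk => ?_
    have := Finset.card_filter_add_card_filter_not (s := D) fun u => G.Adj k u
    have := hnon k hk
    omega
  rw [Finset.sum_add_distrib, Finset.sum_const, Finset.sum_const, smul_eq_mul, smul_eq_mul] at h2
  have h3 := Finset.card_erase_add_one hv
  by_contra! hlt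
  nlinarith

end Hall

namespace MinimalCounterexample

variable {V : Type*} [Fintype V] {G : SimpleGraph V} {d w : ℕ}

protected theorem false (h : MinimalCounterexample G d w) : False := by
  classical
  have o := h.obstruction
  have hne : (Finset.univ : Finset V).Nonempty := by
    rw [Finset.nonempty_iff_ne_empty]
    intro e
    exact h.not_colorable ⟨fun _ => 0, by simp [e], by simp [e]⟩
  obtain ⟨v, -, hmax⟩ := Finset.univ.exists_max_image
    (fun z => (Finset.univ.filter fun u => u ≠ z ∧ ¬ G.Adj z u).card) hne
  set K := Finset.univ.filter fun u => u ≠ v ∧ ¬ G.Adj v u with hKdef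
  have mK : ∀ {u}, u ∈ K ↔ u ≠ v ∧ ¬ G.Adj v u := by simp [K]
  have hKc : ∀ k ∈ K, ∀ l ∈ K, k ≠ l → G.Adj k l := fun k hk l hl hkl =>
    o.nonadj_clique (mK.1 hk).2 (mK.1 hl).2 (mK.1 hk).1 (mK.1 hl).1 hkl
  have hq : 2 < K.card := by
    obtain ⟨a, b, c, ab, ac, bc, va, vb, vc⟩ := o.exists_triangle v
    refine Finset.two_lt_card.2 ⟨a, mK.2 ⟨?_, va⟩, b, mK.2 ⟨?_, vb⟩, c, mK.2 ⟨?_, vc⟩, ab.ne,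
      ac.ne, bc.ne⟩
    · rintro rfl
      exact vb ab
    · rintro rfl
      exact vc bc
    · rintro rfl
      exact va ac.symm
  let C := Finset.univ.filter fun u => u ∉ K ∧ u ≠ v ∧ ∀ k ∈ K, G.Adj u k
  let D := Finset.univ.filter fun u => u ∉ K ∧ ¬ (u ≠ v ∧ ∀ k ∈ K, G.Adj u k)
  have mC : ∀ {u}, u ∈ C ↔ u ∉ K ∧ u ≠ v ∧ ∀ k ∈ K, G.Adj u k := by simp [C]
  have mD : ∀ {u}, u ∈ D ↔ u ∉ K ∧ ¬ (u ≠ v ∧ ∀ k ∈ K, G.Adj u k) := by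
    intro u
    rw [Finset.mem_filter]
    exact and_iff_right (Finset.mem_univ u)
  have hvK : v ∉ K := fun e => (mK.1 e).1 rfl
  have hvD : v ∈ D := mD.2 ⟨hvK, fun e => e.1 rfl⟩
  have hv_adj : ∀ u, u ∉ K → u ≠ v → G.Adj v u := fun u hu huv => by
    by_contra e
    exact hu (mK.2 ⟨huv, e⟩)
  have huniq : ∀ u ∈ D, ∀ k ∈ K, ∀ l ∈ K, G.Adj u k → G.Adj u l → k = l := by
    intro u hu k hk l hl huk hul
    by_contra hkl
    obtain ⟨huK, hu'⟩ := mD.1 hu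
    have huv : u ≠ v := by
      rintro rfl
      exact (mK.1 hk).2 huk
    refine hu' ⟨huv, fun m hm => ?_⟩
    by_cases hkm : k = m
    · exact hkm ▸ huk
    by_cases hlm : l = m
    · exact hlm ▸ hul
    exact o.adj_third (mK.1 hk).2 (mK.1 hl).2 (mK.1 hm).2 (hKc k hk l hl hkl) (hKc k hk m hm hkm)
      (hKc l hl m hm hlm) (hv_adj u huK huv) huk hul
  have hone : ∀ u ∈ D, (K.filter fun k => G.Adj u k).card ≤ 1 := fun u hu =>
    Finset.card_le_one.2 fun k hk l hl => huniq u hu k (Finset.mem_filter.1 hk).1 l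
      (Finset.mem_filter.1 hl).1 (Finset.mem_filter.1 hk).2 (Finset.mem_filter.1 hl).2
  have hDc : ∀ x ∈ D, ∀ y ∈ D, x ≠ y → G.Adj x y := by
    intro x hx y hy hxy
    obtain ⟨k, hk, hkn⟩ := Finset.exists_mem_notMem_of_card_lt_card
      (s := (K.filter fun k => G.Adj x k) ∪ K.filter fun k => G.Adj y k) (t := K) (by
        have := Finset.card_union_le (K.filter fun k => G.Adj x k) (K.filter fun k => G.Adj y k)
        have := hone x hx
        have := hone y hy
        omega)
    have hkx : ¬ G.Adj k x := fun e =>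
      hkn (Finset.mem_union_left _ (Finset.mem_filter.2 ⟨hk, e.symm⟩))
    have hky : ¬ G.Adj k y := fun e =>
      hkn (Finset.mem_union_right _ (Finset.mem_filter.2 ⟨hk, e.symm⟩))
    exact o.nonadj_clique hkx hky (fun e => (mD.1 hx).1 (e ▸ hk)) (fun e => (mD.1 hy).1 (e ▸ hk))
      hxy
  have hDcard : D.card ≤ K.card + 1 := by
    refine card_le_of_unique_neighbor huniq (fun k hk => ?_) hvD (fun k hk => (mK.1 hk).2) hq.le
    refine (Finset.card_le_card fun u hu => ?_).trans (hmax k (Finset.mem_univ k))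
    obtain ⟨huD, hku⟩ := Finset.mem_filter.1 hu
    exact Finset.mem_filter.2 ⟨Finset.mem_univ u, fun e => (mD.1 huD).1 (e ▸ hk), hku⟩
  have hKD := colorableOn_union_max huniq fun k hk => ⟨v, hvD, fun e => (mK.1 hk).2 e.symm⟩
  obtain ⟨Q, hQC, hQ, hQb⟩ := exists_clique_cliqueBound G C
  have hQw : (Q ∪ K).card ≤ w := h.cliqueBound _ (Finset.subset_univ _) (by
    intro x hx y hy hxy
    rcases Finset.mem_union.1 (Finset.mem_coe.1 hx) with hx | hx <;>
      rcases Finset.mem_union.1 (Finset.mem_coe.1 hy) with hy | hy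
    · exact hQ hx hy hxy
    · exact (mC.1 (hQC hx)).2.2 y hy
    · exact ((mC.1 (hQC hy)).2.2 x hx).symm
    · exact hKc x hx y hy hxy)
  rw [Finset.card_union_of_disjoint (Finset.disjoint_left.2 fun x hx => (mC.1 (hQC hx)).1)]
    at hQw
  have hvd : (C ∪ D.erase v).card ≤ d :=
    h.degreeBound v (Finset.mem_univ v) _ (Finset.subset_univ _) (by
      intro y hy
      rcases Finset.mem_union.1 hy with hy | hy
      · exact hv_adj y (mC.1 hy).1 (mC.1 hy).2.1
      · exact hv_adj y (mD.1 (Finset.mem_of_mem_erase hy)).1 (Finset.ne_of_mem_erase hy))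
  rw [Finset.card_union_of_disjoint (Finset.disjoint_left.2 fun x hx hx' =>
    (mD.1 (Finset.mem_of_mem_erase hx')).2 (mC.1 hx).2)] at hvd
  obtain ⟨k, hk⟩ := Finset.card_pos.1 (zero_lt_two.trans hq)
  have hkd : (C ∪ K.erase k).card ≤ d :=
    h.degreeBound k (Finset.mem_univ k) _ (Finset.subset_univ _) (by
      intro y hy
      rcases Finset.mem_union.1 hy with hy | hy
      · exact ((mC.1 hy).2.2 k hk).symm
      · exact hKc k hk y (Finset.mem_of_mem_erase hy) (Finset.ne_of_mem_erase hy).symm)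
  rw [Finset.card_union_of_disjoint (Finset.disjoint_left.2 fun x hx hx' =>
    (mC.1 hx).1 (Finset.mem_of_mem_erase hx'))] at hkd
  have h1 := Finset.card_erase_add_one hvD
  have h2 := Finset.card_erase_add_one hk
  have huniv : K ∪ D ∪ C = Finset.univ := by
    ext u
    simp only [Finset.mem_union, mC, mD, Finset.mem_univ, iff_true]
    tauto
  have hcol := hKD.union (colorableOn_half hQb)
  rw [huniv] at hcol
  exact h.not_colorable (hcol.mono subset_rfl (by omega))

end MinimalCounterexample

section Transfer

variable {V W : Type*} {G : SimpleGraph V} {n d w : ℕ}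

theorem reedOn_comap {e : W ↪ V} {t : Finset W} (h : ReedOn G (t.map e)) :
    ReedOn (G.comap e) t := by
  classical
  intro d w hd hw
  obtain ⟨f, f1, f2⟩ := h d w (by
    intro x hx s hs hxs
    obtain ⟨a, ha, rfl⟩ := Finset.mem_map.1 hx
    obtain ⟨u, hu, rfl⟩ := Finset.subset_map_iff.1 hs
    rw [Finset.card_map]
    exact hd a ha u hu fun y hy => hxs (e y) (Finset.mem_map_of_mem e hy)) (by
    intro s hs hsc
    obtain ⟨u, hu, rfl⟩ := Finset.subset_map_iff.1 hs
    rw [Finset.card_map]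
    exact hw u hu fun x hx y hy hxy => hsc (Finset.mem_map_of_mem e hx)
      (Finset.mem_map_of_mem e hy) (fun h => hxy (e.injective h)))
  exact ⟨f ∘ e, fun x hx => f1 _ (Finset.mem_map_of_mem e hx), fun x hx y hy hxy =>
    f2 _ (Finset.mem_map_of_mem e hx) _ (Finset.mem_map_of_mem e hy) hxy⟩

/-- Reed's bound, in relative form. -/
theorem reedOn_of_noP4K1_of_noKite (hP : NoP4K1 G) (hK : NoKite G) (s : Finset V) :
    ReedOn G s := by
  classical
  induction s using Finset.strongInduction with
  | H s ih =>
  intro d w hd hw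
  let e : s ↪ V := Function.Embedding.subtype _
  by_contra hcol
  refine MinimalCounterexample.false (G := G.comap e) (d := d) (w := w)
    ⟨fun a b c d e' => hP (e a) (e b) (e c) (e d) (e e'),
      fun a b c d e' => hK (e a) (e b) (e c) (e d) (e e'), ?_, ?_, ?_, ?_⟩
  · intro x _ t _ hxt
    rw [← Finset.card_map e]
    refine hd (e x) x.2 _ ?_ ?_
    · intro y hy
      obtain ⟨z, -, rfl⟩ := Finset.mem_map.1 hy
      exact z.2
    · intro y hy
      obtain ⟨z, hz, rfl⟩ := Finset.mem_map.1 hy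
      exact hxt z hz
  · intro t _ htc
    rw [← Finset.card_map e]
    refine hw _ ?_ ?_
    · intro y hy
      obtain ⟨z, -, rfl⟩ := Finset.mem_map.1 hy
      exact z.2
    · intro x hx y hy hxy
      obtain ⟨x', hx', rfl⟩ := Finset.mem_map.1 hx
      obtain ⟨y', hy', rfl⟩ := Finset.mem_map.1 hy
      exact htc hx' hy' fun h => hxy (h ▸ rfl)
  · rintro ⟨f, f1, f2⟩
    refine hcol ⟨fun x => if hx : x ∈ s then f ⟨x, hx⟩ else 0, ?_, ?_⟩
    · intro x hx
      simpa [hx] using f1 ⟨x, hx⟩ (Finset.mem_univ _)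
    · intro x hx y hy hxy
      simpa [hx, hy] using f2 ⟨x, hx⟩ (Finset.mem_univ _) ⟨y, hy⟩ (Finset.mem_univ _) hxy
  · intro t ht
    refine reedOn_comap (ih _ ?_)
    refine (Finset.ssubset_iff_of_subset ?_).2 ?_
    · intro y hy
      obtain ⟨z, -, rfl⟩ := Finset.mem_map.1 hy
      exact z.2
    · obtain ⟨x, hx⟩ : ∃ x, x ∉ t := by
        by_contra! hall
        exact ht (Finset.eq_univ_iff_forall.2 hall)
      exact ⟨e x, x.2, fun h => hx ((Finset.mem_map' e).1 h)⟩

end Transfer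

theorem noP4K1_of_isEmpty {V : Type*} {G : SimpleGraph V} (h : IsEmpty (p4UnionK1 ↪g G)) :
    NoP4K1 G := by
  intro a b c d e ab bc cd nac nad nbd nea neb nec ned
  have hac : a ≠ c := fun h => nad (h ▸ cd)
  have had : a ≠ d := fun h => nac (h ▸ cd.symm)
  have hbd : b ≠ d := fun h => nad (h ▸ ab)
  have hea : e ≠ a := fun h => neb (h ▸ ab)
  have heb : e ≠ b := fun h => nea (h ▸ ab.symm)
  have hec : e ≠ c := fun h => ned (h ▸ cd)
  have hed : e ≠ d := fun h => nec (h ▸ cd.symm)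
  refine h.elim ⟨⟨![a, b, c, d, e], ?_⟩, ?_⟩
  · intro i j hij
    have := ab.ne
    have := bc.ne
    have := cd.ne
    fin_cases i <;> fin_cases j <;> simp_all
  · intro i j
    change G.Adj (![a, b, c, d, e] i) (![a, b, c, d, e] j) ↔ p4UnionK1.Adj i j
    clear h
    fin_cases i <;> fin_cases j <;> simp_all [p4UnionK1, SimpleGraph.adj_comm]

theorem noKite_of_isEmpty {V : Type*} {G : SimpleGraph V} (h : IsEmpty (kite ↪g G)) :
    NoKite G := by
  intro a b c d e ab ac bc ad bd ce ncd nae nbe nde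
  have hcd : c ≠ d := fun h => nde (h ▸ ce)
  have hae : a ≠ e := fun h => nbe (h ▸ ab.symm)
  have hbe : b ≠ e := fun h => nae (h ▸ ab)
  have hde : d ≠ e := fun h => nae (h ▸ ad)
  refine h.elim ⟨⟨![a, b, c, d, e], ?_⟩, ?_⟩
  · intro i j hij
    have := ab.ne
    have := ac.ne
    have := bc.ne
    have := ad.ne
    have := bd.ne
    have := ce.ne
    fin_cases i <;> fin_cases j <;> simp_all
  · intro i j
    change G.Adj (![a, b, c, d, e] i) (![a, b, c, d, e] j) ↔ kite.Adj i j
    clear h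
    fin_cases i <;> fin_cases j <;> simp_all [kite, SimpleGraph.adj_comm]

/-- Reed's conjecture holds for `{P4 ∪ K1, Kite}`-free graphs. -/
theorem reed_p4UnionK1_kite_free {V : Type*} [Fintype V] (G : SimpleGraph V)
    [DecidableRel G.Adj]
    (h1 : IsEmpty (p4UnionK1 ↪g G)) (h2 : IsEmpty (kite ↪g G)) :
    G.chromaticNumber ≤ (((G.maxDegree + G.cliqueNum + 1) ⌈/⌉ 2 : ℕ) : ℕ∞) := by
  classical
  obtain ⟨f, f1, f2⟩ := reedOn_of_noP4K1_of_noKite (noP4K1_of_isEmpty h1) (noKite_of_isEmpty h2)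
    Finset.univ G.maxDegree G.cliqueNum
    (fun x _ t _ hxt => (Finset.card_le_card fun y hy =>
      (G.mem_neighborFinset x y).2 (hxt y hy)).trans (G.degree_le_maxDegree x))
    (fun t _ ht => ht.card_le_cliqueNum)
  rw [Nat.ceilDiv_eq_add_pred_div]
  refine SimpleGraph.Colorable.chromaticNumber_le ⟨SimpleGraph.Coloring.mk
    (fun x => ⟨f x, f1 x (Finset.mem_univ x)⟩) ?_⟩
  intro x y hxy he
  exact f2 x (Finset.mem_univ x) y (Finset.mem_univ y) hxy (Fin.mk.inj he)
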